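/- The space of S₃ × ℤ₃ invariants in (ℂ^{2×2})^{⊗3} is five-dimensional: the ℂ-subspace {T ∈ W | κ(T) = T, c_s(T) = T, c_ρ(T) = T} has dimension 5, where κ is the cyclic shift induced by x⊗y⊗z ↦ z⊗x⊗y, and for g ∈ {s, ρ} with s := [[0,1],[1,0]] and ρ := [[0,−1],[1,−1]], c_g is the diagonal conjugation induced by x⊗y⊗z ↦ (g x g⁻¹)⊗(g y g⁻¹)⊗(g z g⁻¹). -/

import Mathlib

open scoped TensorProduct
open Matrix

noncomputable section

abbrev M2 := Matrix (Fin 2) (Fin 2) ℂ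
abbrev W2 := M2 ⊗[ℂ] (M2 ⊗[ℂ] M2)

/-- the subspace of vectors fixed by a linear endomorphism -/
def fixedSubmodule (f : W2 →ₗ[ℂ] W2) : Submodule ℂ W2 where
  carrier := {T | f T = T}
  add_mem' := by
    intro x y hx hy
    show f (x + y) = x + y
    rw [map_add, hx, hy]
  zero_mem' := f.map_zero
  smul_mem' := by
    intro c x hx
    show f (c • x) = c • x
    rw [LinearMap.map_smul, hx]

def s : M2 := !![0, 1; 1, 0]
def ρ : M2 := !![0, -1; 1, -1]


theorem exists_omega : ∃ w : ℂ, w ^ 2 + w + 1 = 0 := by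
  have hs : ((Real.sqrt 3 : ℝ) : ℂ) ^ 2 = 3 := by
    rw [← Complex.ofReal_pow, Real.sq_sqrt (by norm_num)]; norm_num
  refine ⟨(-1 + Complex.I * (Real.sqrt 3 : ℝ)) / 2, ?_⟩
  have hI := Complex.I_sq
  linear_combination (1 / 4 : ℂ) * Complex.I ^ 2 * hs + (3 / 4 : ℂ) * hI

theorem s_inv : s⁻¹ = s := by
  apply Matrix.inv_eq_right_inv
  ext i j
  fin_cases i <;> fin_cases j <;> simp [s]

theorem ρ_inv : ρ⁻¹ = !![-1, 1; -1, 0] := by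
  apply Matrix.inv_eq_right_inv
  ext i j
  fin_cases i <;> fin_cases j <;> simp [ρ]

/-- eigenvectors of the conjugation by `ρ` -/
def ev (w : ℂ) : Fin 4 → M2 :=
  ![!![1, 0; 0, 1], !![1, -2; 2, -1], !![w, 1; -w ^ 2, -w], !![-w, -w ^ 2; 1, w]]

def eps : Fin 4 → ℂ := ![1, -1, 1, 1]
def tau : Fin 4 → Fin 4 := ![0, 1, 3, 2]
def lam (w : ℂ) : Fin 4 → ℂ := ![1, 1, w ^ 2, w]

theorem ev_s (w : ℂ) (i : Fin 4) : s * ev w i * s⁻¹ = eps i • ev w (tau i) := by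
  rw [s_inv]
  fin_cases i <;> ext j k <;> fin_cases j <;> fin_cases k <;>
    simp [ev, s, eps, tau, Matrix.mul_apply, Fin.sum_univ_two]

theorem ev_ρ (w : ℂ) (hw : w ^ 2 + w + 1 = 0) (i : Fin 4) :
    ρ * ev w i * ρ⁻¹ = lam w i • ev w i := by
  rw [ρ_inv]
  have h2 : w ^ 2 = -w - 1 := by linear_combination hw
  fin_cases i <;> ext j k <;> fin_cases j <;> fin_cases k <;>
    simp [ev, ρ, lam, Matrix.mul_apply, Fin.sum_univ_two, h2] <;> grind

theorem ev_li (w : ℂ) (hw : w ^ 2 + w + 1 = 0) : LinearIndependent ℂ (ev w) := by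
  rw [Fintype.linearIndependent_iff]
  intro g hg
  have h00 := congrFun (congrFun hg 0) 0
  have h01 := congrFun (congrFun hg 0) 1
  have h10 := congrFun (congrFun hg 1) 0
  have h11 := congrFun (congrFun hg 1) 1
  simp [Fin.sum_univ_four, ev] at h00 h01 h10 h11
  have ha : g 0 = 0 := by linear_combination (h00 + h11) / 2
  have hc : g 2 = 0 := by grind
  have hd : g 3 = 0 := by grind
  have hb : g 1 = 0 := by grind
  intro i
  fin_cases i <;> assumption

theorem coord_zero (w : ℂ) (hw : w ^ 2 + w + 1 = 0) (f : Fin 4 → Fin 4 → Fin 4 → ℂ)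
    (h1 : ∀ i j k, f i j k = f j k i)
    (h2 : ∀ i j k, f i j k = eps i * eps j * eps k * f (tau i) (tau j) (tau k))
    (h3 : ∀ i j k, f i j k = lam w i * lam w j * lam w k * f i j k)
    (z0 : f 0 0 0 = 0) (z1 : f 0 1 1 = 0) (z2 : f 0 2 3 = 0) (z3 : f 1 2 3 = 0)
    (z4 : f 2 2 2 = 0) (i j k : Fin 4) : f i j k = 0 := by
  have hw3 : w ^ 3 = 1 := by linear_combination (w - 1) * hw
  have a1 := h3 i j k
  have a2 := h2 i j k
  have a3 := h1 i j k
  have a4 := h1 j k i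
  have a5 := h1 (tau i) (tau j) (tau k)
  have a6 := h1 (tau j) (tau k) (tau i)
  clear h1 h2 h3
  fin_cases i <;> fin_cases j <;> fin_cases k <;>
    simp [eps, tau, lam] at a1 a2 a3 a4 a5 a6 ⊢ <;> grind

set_option maxHeartbeats 1000000 in
/-- The space of `S₃ × ℤ₃` invariants in `(ℂ^{2×2})^{⊗3}` is five-dimensional. -/
theorem S3_Z3_invariants_dimension
    (κ cs cρ : W2 →ₗ[ℂ] W2)
    (hκ : ∀ x y z : M2, κ (x ⊗ₜ[ℂ] (y ⊗ₜ[ℂ] z)) = z ⊗ₜ[ℂ] (x ⊗ₜ[ℂ] y))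
    (hcs : ∀ x y z : M2, cs (x ⊗ₜ[ℂ] (y ⊗ₜ[ℂ] z)) =
      (s * x * s⁻¹) ⊗ₜ[ℂ] ((s * y * s⁻¹) ⊗ₜ[ℂ] (s * z * s⁻¹)))
    (hcρ : ∀ x y z : M2, cρ (x ⊗ₜ[ℂ] (y ⊗ₜ[ℂ] z)) =
      (ρ * x * ρ⁻¹) ⊗ₜ[ℂ] ((ρ * y * ρ⁻¹) ⊗ₜ[ℂ] (ρ * z * ρ⁻¹))) :
    Module.rank ℂ
      (fixedSubmodule κ ⊓ fixedSubmodule cs ⊓ fixedSubmodule cρ : Submodule ℂ W2) = 5 := by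
  obtain ⟨w, hw⟩ := exists_omega
  have hw3 : w ^ 3 = 1 := by linear_combination (w - 1) * hw
  let b : Module.Basis (Fin 4) ℂ M2 :=
    basisOfLinearIndependentOfCardEqFinrank (ev_li w hw) (by simp [Module.finrank_matrix])
  have hb : ∀ i, b i = ev w i := fun i => by simp [b]
  let B := b.tensorProduct (b.tensorProduct b)
  let t : Fin 4 → Fin 4 → Fin 4 → W2 := fun i j k => b i ⊗ₜ[ℂ] (b j ⊗ₜ[ℂ] b k)
  have hB : ∀ i j k, B (i, j, k) = t i j k := fun i j k => by
    simp [B, t, Module.Basis.tensorProduct_apply]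
  have tκ : ∀ i j k, κ (t i j k) = t k i j := fun i j k => hκ _ _ _
  have ts : ∀ i j k, cs (t i j k) =
      (eps i * eps j * eps k) • t (tau i) (tau j) (tau k) := fun i j k => by
    simp only [t]
    rw [hcs, hb, hb, hb, ev_s, ev_s, ev_s, hb, hb, hb]
    simp only [← TensorProduct.smul_tmul', TensorProduct.tmul_smul, smul_smul]
    congr 1; ring
  have tρ : ∀ i j k, cρ (t i j k) =
      (lam w i * lam w j * lam w k) • t i j k := fun i j k => by
    simp only [t]
    rw [hcρ, hb, hb, hb, ev_ρ w hw, ev_ρ w hw, ev_ρ w hw]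
    simp only [← TensorProduct.smul_tmul', TensorProduct.tmul_smul, smul_smul]
    congr 1; ring
  have ct : ∀ i j k i' j' k', B.coord (i, j, k) (t i' j' k') =
      if i' = i ∧ j' = j ∧ k' = k then 1 else 0 := fun i j k i' j' k' => by
    rw [← hB, Module.Basis.coord_apply, Module.Basis.repr_self, Finsupp.single_apply]
    simp [Prod.ext_iff]
  clear_value t B
  have eκ : ∀ i j k T, B.coord (i, j, k) (κ T) = B.coord (j, k, i) T := by
    intro i j k T
    suffices h : B.coord (i, j, k) ∘ₗ κ = B.coord (j, k, i) from LinearMap.congr_fun h T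
    refine B.ext ?_
    rintro ⟨i', j', k'⟩
    rw [LinearMap.comp_apply, hB, tκ, ct, ct]
    congr 1
    apply propext; tauto
  have es : ∀ i j k T, B.coord (i, j, k) (cs T) =
      eps i * eps j * eps k * B.coord (tau i, tau j, tau k) T := by
    intro i j k T
    suffices h : B.coord (i, j, k) ∘ₗ cs =
        (eps i * eps j * eps k) • B.coord (tau i, tau j, tau k) from LinearMap.congr_fun h T
    have hτ : ∀ i j, tau i = j ↔ i = tau j := by decide
    have hε : ∀ i, eps (tau i) = eps i := by
      intro i; fin_cases i <;> simp [eps, tau]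
    refine B.ext ?_
    rintro ⟨i', j', k'⟩
    rw [LinearMap.comp_apply, LinearMap.smul_apply, hB, ts, map_smul, ct, ct]
    simp only [hτ]
    split_ifs with h
    · obtain ⟨rfl, rfl, rfl⟩ := h
      rw [hε, hε, hε]
    · simp
  have eρ : ∀ i j k T, B.coord (i, j, k) (cρ T) =
      lam w i * lam w j * lam w k * B.coord (i, j, k) T := by
    intro i j k T
    suffices h : B.coord (i, j, k) ∘ₗ cρ =
        (lam w i * lam w j * lam w k) • B.coord (i, j, k) from LinearMap.congr_fun h T
    refine B.ext ?_
    rintro ⟨i', j', k'⟩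
    rw [LinearMap.comp_apply, LinearMap.smul_apply, hB, tρ, map_smul, ct]
    split_ifs with h
    · obtain ⟨rfl, rfl, rfl⟩ := h
      rfl
    · simp
  let ix : Fin 5 → Fin 4 × Fin 4 × Fin 4 :=
    ![(0, 0, 0), (0, 1, 1), (0, 2, 3), (1, 2, 3), (2, 2, 2)]
  let E : (fixedSubmodule κ ⊓ fixedSubmodule cs ⊓ fixedSubmodule cρ : Submodule ℂ W2) →ₗ[ℂ]
      (Fin 5 → ℂ) := (LinearMap.pi fun n => B.coord (ix n)) ∘ₗ Submodule.subtype _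
  have hE : ∀ T n, E T n = B.coord (ix n) T.1 := fun T n => rfl
  have hinj : Function.Injective E := by
    rw [injective_iff_map_eq_zero]
    rintro ⟨T, ⟨h1, h2⟩, h3⟩ h
    have h1 : κ T = T := h1
    have h2 : cs T = T := h2
    have h3 : cρ T = T := h3
    apply Subtype.ext
    show T = 0
    apply B.ext_elem
    rintro ⟨i, j, k⟩
    rw [map_zero, Finsupp.zero_apply, ← Module.Basis.coord_apply]
    refine coord_zero w hw (fun i j k => B.coord (i, j, k) T) ?_ ?_ ?_ ?_ ?_ ?_ ?_ ?_ i j k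
    · intro i j k
      show B.coord (i, j, k) T = B.coord (j, k, i) T
      rw [← eκ i j k T, h1]
    · intro i j k
      show B.coord (i, j, k) T = _ * B.coord (tau i, tau j, tau k) T
      rw [← es i j k T, h2]
    · intro i j k
      show B.coord (i, j, k) T = _ * B.coord (i, j, k) T
      rw [← eρ i j k T, h3]
    · exact congrFun h 0
    · exact congrFun h 1
    · exact congrFun h 2
    · exact congrFun h 3
    · exact congrFun h 4
  have hsurj : Function.Surjective E := by
    intro c
    let T : W2 := c 0 • t 0 0 0 + c 1 • (t 0 1 1 + t 1 0 1 + t 1 1 0)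
      + c 2 • (t 0 2 3 + t 3 0 2 + t 2 3 0 + t 0 3 2 + t 2 0 3 + t 3 2 0)
      + c 3 • (t 1 2 3 + t 3 1 2 + t 2 3 1 - t 1 3 2 - t 2 1 3 - t 3 2 1)
      + c 4 • (t 2 2 2 + t 3 3 3)
    have h1 : κ T = T := by
      simp only [T, map_add, map_sub, map_smul, tκ]
      module
    have h2 : cs T = T := by
      simp only [T, map_add, map_sub, map_smul, ts]
      simp [eps, tau]
      module
    have h3 : cρ T = T := by
      have e1 : w ^ 2 * w = 1 := by linear_combination hw3
      have e2 : w * w ^ 2 = 1 := by linear_combination hw3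
      have e3 : w ^ 2 * w ^ 2 * w ^ 2 = 1 := by linear_combination (w ^ 3 + 1) * hw3
      have e4 : w * w * w = 1 := by linear_combination hw3
      simp only [T, map_add, map_sub, map_smul, tρ]
      simp [lam, e1, e2, e3, e4]
    refine ⟨⟨T, ⟨h1, h2⟩, h3⟩, ?_⟩
    funext n
    rw [hE]
    show B.coord (ix n) T = c n
    simp only [T, map_add, map_sub, map_smul]
    fin_cases n <;> simp [ix, ct, -Module.Basis.coord_apply]
  rw [(LinearEquiv.ofBijective E ⟨hinj, hsurj⟩).rank_eq]
  simp
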